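/- Let w, s, t be positive integers with t ∣ s and t ≠ s, and suppose 2¹ ∥ (s/t) (i.e. 2 ∣ s/t but 4 ∤ s/t). Then for every l ∈ I(s/(2t)), the integer f(l) := ∑_{k ∈ {l, 2l}} (−1)^{ω(s/(kt))} (−1)^{ktw} binom(k(tw−1)−1, k−1) satisfies f(l) ≡ 0 (mod 4). -/

import Mathlib

/-- Generalized binomial coefficient `binom(n, j) = n(n−1)⋯(n−j+1)/j! ∈ ℤ`. -/
noncomputable def binom (n : ℤ) (j : ℕ) : ℤ := Ring.choose n j

/-- `I(n) = {k : k ∣ n and n/k is squarefree}` as a finset. -/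
def Iset (n : ℕ) : Finset ℕ := n.divisors.filter fun k => Squarefree (n / k)

/-- `ω(n)`: the number of distinct prime factors of `n`. -/
def omega (n : ℕ) : ℕ := n.primeFactors.card

lemma choose_mul_fact (x : ℤ) (k : ℕ) :
    (k.factorial : ℤ) * Ring.choose x k = ∏ i ∈ Finset.range k, (x - i) := by
  have h := Ring.descPochhammer_eq_factorial_smul_choose x k
  rw [nsmul_eq_mul] at h
  rw [← h, ← Polynomial.eval_eq_smeval, descPochhammer_eval_eq_prod_range]

lemma prod_split (n : ℤ) (k : ℕ) :
    ∏ i ∈ Finset.range (2 * k + 1), (2 * n - 1 - (i : ℤ)) =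
      2 ^ k * (∏ i ∈ Finset.range k, (n - 1 - (i : ℤ))) *
        ∏ i ∈ Finset.range (k + 1), (2 * n - (2 * (i : ℤ) + 1)) := by
  induction k with
  | zero => simp
  | succ k ih =>
    rw [show 2 * (k + 1) + 1 = (2 * k + 1) + 1 + 1 by ring, Finset.prod_range_succ,
      Finset.prod_range_succ, ih, Finset.prod_range_succ _ (k + 1),
      Finset.prod_range_succ (fun i : ℕ => (n - 1 - (i : ℤ))) k]
    push_cast
    ring

lemma fact_split (k : ℕ) :
    ((2 * k + 1).factorial : ℤ) =
      2 ^ k * (k.factorial : ℤ) * ∏ i ∈ Finset.range (k + 1), (2 * (i : ℤ) + 1) := by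
  induction k with
  | zero => simp
  | succ k ih =>
    rw [show 2 * (k + 1) + 1 = (2 * k + 1) + 1 + 1 by ring, Nat.factorial_succ,
      Nat.factorial_succ (2 * k + 1), Nat.factorial_succ k, Finset.prod_range_succ _ (k + 1)]
    push_cast
    rw [ih]
    ring

lemma choose_split (n : ℤ) (k : ℕ) :
    Ring.choose (2 * n - 1) (2 * k + 1) * ∏ i ∈ Finset.range (k + 1), (2 * (i : ℤ) + 1) =
      Ring.choose (n - 1) k * ∏ i ∈ Finset.range (k + 1), (2 * n - (2 * (i : ℤ) + 1)) := by
  have h1 := choose_mul_fact (2 * n - 1) (2 * k + 1)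
  have h2 := choose_mul_fact (n - 1) k
  rw [prod_split, fact_split, ← h2] at h1
  have h0 : (2 ^ k * (k.factorial : ℤ)) ≠ 0 := by positivity
  apply mul_left_cancel₀ h0
  linear_combination h1

lemma prod_even (n : ℤ) (hn : Even n) (k : ℕ) :
    ∏ i ∈ Finset.range k, (2 * n - (2 * (i : ℤ) + 1)) ≡
      (-1) ^ k * ∏ i ∈ Finset.range k, (2 * (i : ℤ) + 1) [ZMOD 4] := by
  induction k with
  | zero => simp
  | succ k ih =>
    rw [Finset.prod_range_succ, Finset.prod_range_succ, pow_succ]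
    have : 2 * n - (2 * (k : ℤ) + 1) ≡ -(2 * (k : ℤ) + 1) [ZMOD 4] := by
      obtain ⟨c, rfl⟩ := hn
      rw [Int.modEq_iff_dvd]; exact ⟨-c, by ring⟩
    have h := ih.mul this
    convert h using 1
    ring

lemma prod_odd (n : ℤ) (hn : Odd n) (k : ℕ) :
    ∏ i ∈ Finset.range k, (2 * n - (2 * (i : ℤ) + 1)) ≡
      ∏ i ∈ Finset.range k, (2 * (i : ℤ) + 1) [ZMOD 4] := by
  induction k with
  | zero => simp
  | succ k ih =>
    rw [Finset.prod_range_succ, Finset.prod_range_succ]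
    have : 2 * n - (2 * (k : ℤ) + 1) ≡ (2 * (k : ℤ) + 1) [ZMOD 4] := by
      obtain ⟨c, rfl⟩ := hn
      rw [Int.modEq_iff_dvd]; exact ⟨k - c, by ring⟩
    exact ih.mul this

lemma cop (k : ℕ) : IsCoprime (4 : ℤ) (∏ i ∈ Finset.range k, (2 * (i : ℤ) + 1)) := by
  apply IsCoprime.prod_right
  intro i _
  have : IsCoprime (2 : ℤ) (2 * (i : ℤ) + 1) := ⟨-i, 1, by ring⟩
  simpa using this.pow_left (m := 2)

lemma cancel_four {a b p : ℤ} (hp : IsCoprime 4 p) (h : a * p ≡ b * p [ZMOD 4]) :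
    a ≡ b [ZMOD 4] := by
  rw [Int.modEq_iff_dvd] at *
  rw [← sub_mul] at h
  exact hp.dvd_of_dvd_mul_right h

lemma choose_mod (l : ℕ) (hl : Odd l) (a : ℕ) :
    Ring.choose (2 * ((l : ℤ) * ((a : ℤ) - 1)) - 1) (2 * l - 1) ≡
      (-1) ^ a * Ring.choose ((l : ℤ) * ((a : ℤ) - 1) - 1) (l - 1) [ZMOD 4] := by
  obtain ⟨k, rfl⟩ : ∃ k, l = k + 1 := ⟨l - 1, by have := hl.pos; omega⟩
  have hl' : Odd (((k + 1 : ℕ) : ℤ)) := by exact_mod_cast hl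
  generalize hn : (((k + 1 : ℕ) : ℤ) * ((a : ℤ) - 1)) = n
  have hs := choose_split n k
  rw [show 2 * (k + 1) - 1 = 2 * k + 1 by omega, show k + 1 - 1 = k by omega]
  apply cancel_four (cop (k + 1))
  rw [hs]
  rcases Nat.even_or_odd a with ha | ha
  · have : Odd n := by
      rw [← hn]; apply hl'.mul
      have : Even (a : ℤ) := by exact_mod_cast ha
      exact this.sub_odd odd_one
    rw [ha.neg_one_pow, one_mul]
    exact (prod_odd n this (k + 1)).mul_left _
  · have : Even n := by
      rw [← hn]; apply Even.mul_left
      have : Odd (a : ℤ) := by exact_mod_cast ha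
      exact this.sub_odd odd_one
    have h := (prod_even n this (k + 1)).mul_left (Ring.choose (n - 1) k)
    rw [hl.neg_one_pow] at h
    rw [ha.neg_one_pow]
    convert h using 1
    ring

lemma omega_two_mul (q : ℕ) (hq : Odd q) : omega (2 * q) = omega q + 1 := by
  unfold omega
  have hc : Nat.Coprime 2 q := (Nat.coprime_two_left).2 hq
  rw [hc.primeFactors_mul, Finset.card_union_of_disjoint hc.disjoint_primeFactors,
    Nat.prime_two.primeFactors]
  simp [add_comm]

/-- Let `t ∣ s`, `t ≠ s`, and `2 ∥ s/t` (i.e. `2 ∣ s/t` but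
`4 ∤ s/t`). Then for every `l ∈ I(s/(2t))`, the integer
`f(l) = ∑_{k ∈ {l, 2l}} (−1)^{ω(s/(kt))} (−1)^{ktw} binom(k(tw−1)−1, k−1)`
is `≡ 0 (mod 4)`. -/
theorem f_vanishes_mod_four (w s t : ℕ) (hw : 1 ≤ w) (hs : 1 ≤ s)
    (ht : 1 ≤ t) (hts : t ∣ s) (hne : t ≠ s)
    (hdvd : 2 ∣ s / t) (hndvd : ¬ 4 ∣ s / t) :
    ∀ l ∈ Iset (s / (2 * t)),
      ((-1 : ℤ) ^ omega (s / (l * t)) * (-1 : ℤ) ^ (l * t * w) *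
            binom ((l : ℕ) * ((t : ℤ) * (w : ℤ) - 1) - 1) (l - 1) +
          (-1 : ℤ) ^ omega (s / (2 * l * t)) * (-1 : ℤ) ^ (2 * l * t * w) *
            binom ((2 * l : ℕ) * ((t : ℤ) * (w : ℤ) - 1) - 1) (2 * l - 1)) ≡ 0 [ZMOD 4] := by
  intro l hl
  obtain ⟨c, hc⟩ := hdvd
  have hs' : s = t * (2 * c) := by rw [← hc]; exact (Nat.mul_div_cancel' hts).symm
  have h1 : s / (2 * t) = c := by
    rw [hs', show t * (2 * c) = (2 * t) * c by ring]
    exact Nat.mul_div_cancel_left _ (by omega)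
  have hcodd : Odd c := by
    rw [← Nat.not_even_iff_odd]
    rintro ⟨d, rfl⟩
    exact hndvd ⟨d, by rw [hc]; ring⟩
  rw [h1] at hl
  have hlc : l ∣ c := by
    unfold Iset at hl
    exact Nat.dvd_of_mem_divisors (Finset.mem_filter.1 hl).1
  obtain ⟨q, rfl⟩ := hlc
  have hlodd : Odd l := (Nat.odd_mul.1 hcodd).1
  have hqodd : Odd q := (Nat.odd_mul.1 hcodd).2
  have hlpos := hlodd.pos
  have e1 : s / (l * t) = 2 * q := by
    rw [hs', show t * (2 * (l * q)) = (l * t) * (2 * q) by ring]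
    exact Nat.mul_div_cancel_left _ (by positivity)
  have e2 : s / (2 * l * t) = q := by
    rw [hs', show t * (2 * (l * q)) = (2 * l * t) * q by ring]
    exact Nat.mul_div_cancel_left _ (by positivity)
  rw [e1, e2, omega_two_mul q hqodd]
  have p1 : (-1 : ℤ) ^ (l * t * w) = (-1) ^ (t * w) := by
    rw [mul_assoc, pow_mul, hlodd.neg_one_pow]
  have p2 : (-1 : ℤ) ^ (2 * l * t * w) = 1 := by
    rw [mul_assoc, mul_assoc, pow_mul]; simp
  rw [p1, p2]
  have key := choose_mod l hlodd (t * w)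
  unfold binom
  push_cast at key ⊢
  rw [← mul_assoc] at key
  have key2 := key.mul_left ((-1 : ℤ) ^ omega q)
  rw [Int.modEq_iff_dvd] at key2 ⊢
  convert key2 using 1
  ring
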